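/- arXiv:2102.12792 — 4 statements merged into one kernel-verified Lean document; each statement's English description precedes it below -/
import Mathlib

section
/- (Theorem 1, positive definiteness of FM kernels.) Let D ≥ 1 and n ≥ 1, let U be an n × n real orthogonal matrix with L = U · diag(λ_1,…,λ_n) · Uᵀ for real numbers λ_1,…,λ_n, and suppose that for each i ∈ {1,…,n} the function (c,c') ↦ f(λ_i, c, c') is a positive definite kernel on ℝ^D × ℝ^D. Then the frequency modulated kernel k : (ℝ^D × {1,…,n}) × (ℝ^D × {1,…,n}) → ℝ defined by k((c,v),(c',v')) = Σ_{i=1}^{n} U_{v,i} · f(λ_i, c, c') · U_{v',i} is a positive definite kernel jointly on ℝ^D × {1,…,n}. -/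
open scoped BigOperators Matrix

/-- A real-valued positive definite kernel on `X`. -/
def IsPDKernel {X : Type*} (k : X → X → ℝ) : Prop :=
  ∀ (m : ℕ) (x : Fin m → X) (a : Fin m → ℝ),
    0 ≤ ∑ i, ∑ j, a i * a j * k (x i) (x j)

/-- Theorem 1: if for each eigenvalue `λ_i` of `L = U diag(λ) Uᵀ` the function
`(c,c') ↦ f (λ_i) c c'` is a positive definite kernel on `ℝ^D × ℝ^D`, then the
frequency modulated kernel
`k((c,v),(c',v')) = ∑ i, U_{v,i} ⬝ f (λ_i) c c' ⬝ U_{v',i}`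
is a positive definite kernel jointly on `ℝ^D × {1,…,n}`. -/
theorem fm_kernel_positive_definite {D n : ℕ} (hD : 1 ≤ D) (hn : 1 ≤ n)
    (U L : Matrix (Fin n) (Fin n) ℝ) (hU : U * Uᵀ = 1)
    (lam : Fin n → ℝ) (hL : L = U * Matrix.diagonal lam * Uᵀ)
    (f : ℝ → (Fin D → ℝ) → (Fin D → ℝ) → ℝ)
    (hf : ∀ i : Fin n, IsPDKernel (fun c c' : Fin D → ℝ => f (lam i) c c')) :
    IsPDKernel (fun p q : (Fin D → ℝ) × Fin n =>
      ∑ i, U p.2 i * f (lam i) p.1 q.1 * U q.2 i) := by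
  intro m x a
  have h : ∑ s, ∑ t, a s * a t * (∑ i, U (x s).2 i * f (lam i) (x s).1 (x t).1 * U (x t).2 i)
      = ∑ i, ∑ s, ∑ t, (a s * U (x s).2 i) * (a t * U (x t).2 i) *
          f (lam i) (x s).1 (x t).1 := by
    rw [Finset.sum_comm]
    simp only [Finset.mul_sum]
    rw [Finset.sum_comm]
    conv_rhs => rw [Finset.sum_comm]
    refine Finset.sum_congr rfl fun s _ => ?_
    conv_rhs => rw [Finset.sum_comm]
    refine Finset.sum_congr rfl fun t _ => ?_
    refine Finset.sum_congr rfl fun i _ => ?_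
    ring
  change 0 ≤ ∑ s, ∑ t, a s * a t * (∑ i, U (x s).2 i * f (lam i) (x s).1 (x t).1 * U (x t).2 i)
  rw [h]
  exact Finset.sum_nonneg fun i _ =>
    hf i m (fun s => (x s).1) (fun s => a s * U (x s).2 i)
end

section
/- (FM-P2 for the basic frequency modulating function.) Let D ≥ 1, let θ_1,…,θ_D > 0, let t ∈ (0,2], let p ≥ 1 be a natural number, let α ≥ 0 and let r ≥ 0 (playing the role of βλ with β, λ ≥ 0). Then the function (c,c') ↦ 1 / (1 + r + α · (‖c − c'‖_θ)^t)^p is a positive definite kernel on ℝ^D × ℝ^D, where ‖c − c'‖_θ² = Σ_{d=1}^{D} (c_d − c'_d)² / θ_d². -/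
open scoped BigOperators

/-- The weighted norm `‖c − c'‖_θ` with `‖c − c'‖_θ² = ∑ d, (c_d − c'_d)²/θ_d²`. -/
noncomputable def wnorm {D : ℕ} (θ : Fin D → ℝ) (c c' : Fin D → ℝ) : ℝ :=
  Real.sqrt (∑ d, (c d - c' d) ^ 2 / θ d ^ 2)

/-- Symmetric positive semidefinite array. -/
def FMPsd {m : ℕ} (k : Fin m → Fin m → ℝ) : Prop :=
  (∀ i j, k i j = k j i) ∧ ∀ a : Fin m → ℝ, 0 ≤ ∑ i, ∑ j, a i * a j * k i j

/-- Nonnegative symmetric conditionally negative definite array with zero diagonal. -/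
def FMCnd {m : ℕ} (k : Fin m → Fin m → ℝ) : Prop :=
  (∀ i j, k i j = k j i) ∧ (∀ i, k i i = 0) ∧ (∀ i j, 0 ≤ k i j) ∧
    ∀ a : Fin m → ℝ, ∑ i, a i = 0 → ∑ i, ∑ j, a i * a j * k i j ≤ 0

theorem FMPsd_iff {m : ℕ} (k : Fin m → Fin m → ℝ) :
    FMPsd k ↔ (Matrix.of k).PosSemidef := by
  rw [Matrix.posSemidef_iff_dotProduct_mulVec]
  unfold FMPsd
  refine and_congr ?_ ?_
  · constructor
    · intro h
      ext i j
      simp [h j i]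
    · intro h i j
      have := congrFun (congrFun h j) i
      simpa using this
  · refine forall_congr' fun a => ?_
    have : star a ⬝ᵥ ((Matrix.of k).mulVec a) = ∑ i, ∑ j, a i * a j * k i j := by
      simp only [dotProduct, Matrix.mulVec, Finset.mul_sum]
      refine Finset.sum_congr rfl fun i _ => Finset.sum_congr rfl fun j _ => ?_
      simp
      ring
    rw [this]

theorem FMPsd.mul {m : ℕ} {k l : Fin m → Fin m → ℝ} (hk : FMPsd k) (hl : FMPsd l) :
    FMPsd (fun i j => k i j * l i j) := by
  rw [FMPsd_iff] at *
  exact hk.hadamard hl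

theorem FMPsd.rank_one {m : ℕ} (f : Fin m → ℝ) : FMPsd (fun i j => f i * f j) := by
  refine ⟨fun i j => mul_comm _ _, fun a => ?_⟩
  have : ∑ i, ∑ j, a i * a j * (f i * f j) = (∑ i, a i * f i) ^ 2 := by
    rw [sq, Finset.sum_mul_sum]
    refine Finset.sum_congr rfl fun i _ => Finset.sum_congr rfl fun j _ => ?_
    ring
  rw [this]
  positivity

theorem FMPsd.pow {m : ℕ} {k : Fin m → Fin m → ℝ} (hk : FMPsd k) (n : ℕ) :
    FMPsd (fun i j => k i j ^ n) := by
  induction n with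
  | zero => simpa using FMPsd.rank_one (fun _ : Fin m => (1 : ℝ))
  | succ n ih => simpa [pow_succ] using ih.mul hk

theorem FMPsd.smul {m : ℕ} {k : Fin m → Fin m → ℝ} (hk : FMPsd k) {s : ℝ} (hs : 0 ≤ s) :
    FMPsd (fun i j => s * k i j) := by
  refine ⟨fun i j => by simp only [hk.1 i j], fun a => ?_⟩
  have : ∑ i, ∑ j, a i * a j * (s * k i j) = s * ∑ i, ∑ j, a i * a j * k i j := by
    simp only [Finset.mul_sum]
    refine Finset.sum_congr rfl fun i _ => Finset.sum_congr rfl fun j _ => ?_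
    ring
  rw [this]
  exact mul_nonneg hs (hk.2 a)

theorem FMPsd.exp {m : ℕ} {k : Fin m → Fin m → ℝ} (hk : FMPsd k) :
    FMPsd (fun i j => Real.exp (k i j)) := by
  refine ⟨fun i j => by simp only [hk.1 i j], fun a => ?_⟩
  have h : HasSum (fun n : ℕ => ∑ i, ∑ j, a i * a j * (k i j ^ n / (n.factorial : ℝ)))
      (∑ i, ∑ j, a i * a j * Real.exp (k i j)) := by
    refine hasSum_sum fun i _ => hasSum_sum fun j _ => HasSum.mul_left _ ?_
    rw [Real.exp_eq_exp_ℝ]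
    exact NormedSpace.expSeries_div_hasSum_exp (k i j)
  refine h.nonneg fun n => ?_
  have := ((hk.pow n).smul (s := (n.factorial : ℝ)⁻¹) (by positivity)).2 a
  simpa [div_eq_inv_mul] using this

theorem FMCnd.exp {m : ℕ} {k : Fin m → Fin m → ℝ} (hk : FMCnd k) {s : ℝ} (hs : 0 ≤ s) :
    FMPsd (fun i j => Real.exp (-(s * k i j))) := by
  obtain ⟨h1, h2, h3, h4⟩ := hk
  cases m with
  | zero => exact ⟨fun i => i.elim0, fun a => by simp⟩
  | succ m =>
    have hB : FMPsd (fun i j => k i 0 + k j 0 - k i j) := by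
      refine ⟨fun i j => by simp only [h1 i j]; ring, fun b => ?_⟩
      set S := ∑ i, b i with hS
      have := h4 (fun i => b i - S * (if i = 0 then 1 else 0)) (by
        simp [Finset.sum_sub_distrib, hS])
      have e1 : ∑ i, ∑ j, (b i - S * (if i = 0 then 1 else 0)) *
          (b j - S * (if j = 0 then 1 else 0)) * k i j
          = (∑ i, ∑ j, b i * b j * k i j) - 2 * S * ∑ i, b i * k i 0 := by
        have e : ∀ i j, (b i - S * (if i = 0 then 1 else 0)) *
          (b j - S * (if j = 0 then 1 else 0)) * k i j = b i * b j * k i j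
            - (if j = 0 then S * (b i * k i j) else 0) - (if i = 0 then S * (b j * k j i) else 0)
            + (if i = 0 then (if j = 0 then S * S * k i j else 0) else 0) := by
          intro i j
          rw [h1 j i]
          split_ifs <;> ring
        simp only [e, Finset.sum_add_distrib, Finset.sum_sub_distrib]
        rw [Finset.sum_comm (f := fun i j => if i = 0 then S * (b j * k j i) else 0)]
        simp [h2, ← Finset.mul_sum]
        ring
      have e2 : ∑ i, ∑ j, b i * b j * (k i 0 + k j 0 - k i j)
          = 2 * S * ∑ i, b i * k i 0 - ∑ i, ∑ j, b i * b j * k i j := by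
        have e : ∀ i j, b i * b j * (k i 0 + k j 0 - k i j) =
            (b i * k i 0) * b j + b i * (b j * k j 0) - b i * b j * k i j := by
          intro i j; ring
        simp only [e, Finset.sum_add_distrib, Finset.sum_sub_distrib, ← Finset.mul_sum,
          ← Finset.sum_mul, ← hS]
        ring
      rw [e2]
      rw [e1] at this
      linarith
    have := (FMPsd.rank_one (fun i => Real.exp (-(s * k i 0)))).mul (hB.smul hs).exp
    convert this using 3 with i j
    rw [← Real.exp_add, ← Real.exp_add]
    congr 1
    ring

theorem FMCnd.inv {m : ℕ} {k : Fin m → Fin m → ℝ} (hk : FMCnd k) {c : ℝ} (hc : 0 < c) :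
    FMPsd (fun i j => (c + k i j)⁻¹) := by
  refine ⟨fun i j => by simp only [hk.1 i j], fun a => ?_⟩
  have hpos : ∀ i j, 0 < c + k i j := fun i j => by have := hk.2.2.1 i j; linarith
  have hI : ∀ i j, MeasureTheory.IntegrableOn
      (fun s : ℝ => Real.exp (-(c + k i j) * s)) (Set.Ioi 0) := fun i j =>
    integrableOn_exp_mul_Ioi (by linarith [hpos i j]) 0
  have hv : ∀ i j, (c + k i j)⁻¹ = ∫ s in Set.Ioi (0 : ℝ), Real.exp (-(c + k i j) * s) := by
    intro i j
    rw [integral_exp_mul_Ioi (by linarith [hpos i j]) 0]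
    simp [neg_div_neg_eq, -neg_add_rev]
  have : ∑ i, ∑ j, a i * a j * (c + k i j)⁻¹ = ∫ s in Set.Ioi (0 : ℝ),
      ∑ i, ∑ j, a i * a j * Real.exp (-(c + k i j) * s) := by
    rw [MeasureTheory.integral_finsetSum _ fun i _ =>
      MeasureTheory.integrable_finsetSum _ fun j _ => (hI i j).const_mul _]
    refine Finset.sum_congr rfl fun i _ => ?_
    rw [MeasureTheory.integral_finsetSum _ fun j _ => (hI i j).const_mul _]
    refine Finset.sum_congr rfl fun j _ => ?_
    rw [MeasureTheory.integral_const_mul, hv]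
  rw [this]
  refine MeasureTheory.setIntegral_nonneg measurableSet_Ioi fun s hs => ?_
  have hs' : (0 : ℝ) ≤ s := le_of_lt hs
  have := ((hk.exp hs').smul (Real.exp_pos (-(c * s))).le).2 a
  convert this using 5 with i _ j
  beta_reduce
  rw [← Real.exp_add]
  congr 1
  ring

theorem FMCnd.rpow {m : ℕ} {k : Fin m → Fin m → ℝ} (hk : FMCnd k) {q : ℝ}
    (hq : q ∈ Set.Ioo (0 : ℝ) 1) : FMCnd (fun i j => k i j ^ q) := by
  refine ⟨fun i j => by simp only [hk.1 i j], fun i => by simp only [hk.2.1, Real.zero_rpow hq.1.ne'],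
    fun i j => Real.rpow_nonneg (hk.2.2.1 i j) _, fun a ha => ?_⟩
  set C : ℝ := (∫ t in Set.Ioi (0 : ℝ), Real.rpowIntegrand₀₁ q t 1)⁻¹ with hC
  have hCn : 0 ≤ C := inv_nonneg.2 <| MeasureTheory.setIntegral_nonneg measurableSet_Ioi
    fun s hs => Real.rpowIntegrand₀₁_nonneg hq.1 (le_of_lt hs) zero_le_one
  have hI : ∀ i j, MeasureTheory.IntegrableOn
      (fun s : ℝ => Real.rpowIntegrand₀₁ q s (k i j)) (Set.Ioi 0) := fun i j =>
    Real.integrableOn_rpowIntegrand₀₁_Ioi hq (hk.2.2.1 i j)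
  have : ∑ i, ∑ j, a i * a j * k i j ^ q = C * ∫ s in Set.Ioi (0 : ℝ),
      ∑ i, ∑ j, a i * a j * Real.rpowIntegrand₀₁ q s (k i j) := by
    rw [MeasureTheory.integral_finsetSum _ fun i _ =>
      MeasureTheory.integrable_finsetSum _ fun j _ => (hI i j).const_mul _, Finset.mul_sum]
    refine Finset.sum_congr rfl fun i _ => ?_
    rw [MeasureTheory.integral_finsetSum _ fun j _ => (hI i j).const_mul _, Finset.mul_sum]
    refine Finset.sum_congr rfl fun j _ => ?_
    rw [MeasureTheory.integral_const_mul, Real.rpow_eq_const_mul_integral hq (hk.2.2.1 i j)]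
    ring
  rw [this]
  refine mul_nonpos_of_nonneg_of_nonpos hCn ?_
  refine MeasureTheory.setIntegral_nonpos measurableSet_Ioi fun s hs => ?_
  have hs' : (0 : ℝ) < s := hs
  have h := ((hk.inv hs').smul (Real.rpow_nonneg hs'.le q)).2 a
  have e : ∑ i, ∑ j, a i * a j * Real.rpowIntegrand₀₁ q s (k i j) =
      (∑ i, a i) * (∑ j, a j) * (s ^ q * s⁻¹) -
        ∑ i, ∑ j, a i * a j * (s ^ q * (s + k i j)⁻¹) := by
    rw [Finset.sum_mul_sum, Finset.sum_mul, ← Finset.sum_sub_distrib]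
    refine Finset.sum_congr rfl fun i _ => ?_
    rw [Finset.sum_mul, ← Finset.sum_sub_distrib]
    refine Finset.sum_congr rfl fun j _ => ?_
    unfold Real.rpowIntegrand₀₁
    ring
  rw [e, ha]
  linarith

theorem FMCnd.const_mul {m : ℕ} {k : Fin m → Fin m → ℝ} (hk : FMCnd k) {s : ℝ} (hs : 0 ≤ s) :
    FMCnd (fun i j => s * k i j) := by
  refine ⟨fun i j => by simp only [hk.1 i j], fun i => by simp only [hk.2.1, mul_zero],
    fun i j => mul_nonneg hs (hk.2.2.1 i j), fun a ha => ?_⟩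
  have : ∑ i, ∑ j, a i * a j * (s * k i j) = s * ∑ i, ∑ j, a i * a j * k i j := by
    simp only [Finset.mul_sum]
    refine Finset.sum_congr rfl fun i _ => Finset.sum_congr rfl fun j _ => ?_
    ring
  rw [this]
  exact mul_nonpos_of_nonneg_of_nonpos hs (hk.2.2.2 a ha)

theorem FMCnd.sqdist {m D : ℕ} (θ : Fin D → ℝ) (x : Fin m → Fin D → ℝ) :
    FMCnd (fun i j => ∑ d, (x i d - x j d) ^ 2 / θ d ^ 2) := by
  refine ⟨fun i j => Finset.sum_congr rfl fun d _ => by ring, fun i => by simp,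
    fun i j => by positivity, fun a ha => ?_⟩
  have e : ∑ i, ∑ j, a i * a j * ∑ d, (x i d - x j d) ^ 2 / θ d ^ 2 =
      ∑ d, -(2 * (∑ i, a i * x i d) ^ 2 / θ d ^ 2) := by
    have e1 : ∀ d, ∑ i, ∑ j, a i * a j * ((x i d - x j d) ^ 2 / θ d ^ 2) =
        -(2 * (∑ i, a i * x i d) ^ 2 / θ d ^ 2) := by
      intro d
      have e2 : ∀ i j, a i * a j * ((x i d - x j d) ^ 2 / θ d ^ 2) =
          (a i * x i d ^ 2 / θ d ^ 2) * a j + a i * (a j * x j d ^ 2 / θ d ^ 2)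
            - (2 / θ d ^ 2 * (a i * x i d)) * (a j * x j d) := by
        intro i j; ring
      simp only [e2, Finset.sum_add_distrib, Finset.sum_sub_distrib, ← Finset.mul_sum,
          ← Finset.sum_mul, ha]
      ring
    simp only [← e1, Finset.mul_sum]
    rw [Finset.sum_comm]
    rw [Finset.sum_comm]
    simp only [Finset.sum_comm (s := (Finset.univ : Finset (Fin D)))]
  rw [e]
  refine Finset.sum_nonpos fun d _ => ?_
  have : 0 ≤ 2 * (∑ i, a i * x i d) ^ 2 / θ d ^ 2 := by positivity
  linarith

/-- FM-P2 for the basic frequency modulating function: for `t ∈ (0,2]`, `p ≥ 1`,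
`α ≥ 0` and `r ≥ 0`, the function `(c,c') ↦ 1/(1 + r + α‖c−c'‖_θ^t)^p` is a positive
definite kernel on `ℝ^D × ℝ^D`. -/
theorem basic_fm_function_pd {D : ℕ} (hD : 1 ≤ D)
    (θ : Fin D → ℝ) (hθ : ∀ d, 0 < θ d)
    (t : ℝ) (ht : t ∈ Set.Ioc (0 : ℝ) 2)
    (p : ℕ) (hp : 1 ≤ p)
    (α r : ℝ) (hα : 0 ≤ α) (hr : 0 ≤ r) :
    IsPDKernel (fun c c' : Fin D → ℝ =>
      1 / (1 + r + α * wnorm θ c c' ^ t) ^ p) := by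
  intro m x a
  have hS := FMCnd.sqdist θ x
  have hN : FMCnd (fun i j => wnorm θ (x i) (x j) ^ t) := by
    have e : (fun i j => wnorm θ (x i) (x j) ^ t) =
        fun i j => (∑ d, (x i d - x j d) ^ 2 / θ d ^ 2) ^ (t / 2) := by
      funext i j
      rw [wnorm, Real.sqrt_eq_rpow, ← Real.rpow_mul (hS.2.2.1 i j)]
      congr 1
      ring
    rw [e]
    rcases eq_or_lt_of_le ht.2 with h | h
    · subst h
      simpa using hS
    · exact hS.rpow ⟨by linarith [ht.1], by linarith⟩
  have := (((hN.const_mul hα).inv (c := 1 + r) (by linarith)).pow p).2 a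
  simpa [one_div] using this
end

section
/- (FM-P3, the frequency modulation principle, for the basic frequency modulating function.) Let p ≥ 1 be a natural number, let τ ∈ (0,2], let α > 0, β > 0, and let 0 ≤ t_1 < t_2 be real numbers. Then the function h : [0,∞) → ℝ defined by h(s) = (1 + βs + α·t_1^τ)^{−p} − (1 + βs + α·t_2^τ)^{−p} is positive on [0,∞), strictly decreasing on [0,∞), and convex on [0,∞). -/
open scoped BigOperators

noncomputable def fmH (β a b : ℝ) (q : ℕ) (s : ℝ) : ℝ :=
  1 / (1 + β * s + a) ^ q - 1 / (1 + β * s + b) ^ q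

lemma fm_aux (β a : ℝ) (q : ℕ) (s : ℝ) (h : 0 < 1 + β * s + a) :
    HasDerivAt (fun s : ℝ => 1 / (1 + β * s + a) ^ q)
      (-(q * β) * (1 / (1 + β * s + a) ^ (q + 1))) s := by
  have h1 : HasDerivAt (fun s : ℝ => 1 + β * s + a) β s := by
    simpa using (((hasDerivAt_id s).const_mul β).const_add 1).add_const a
  have h2 := (h1.pow q).inv (pow_ne_zero q h.ne')
  have e : (fun s : ℝ => 1 / (1 + β * s + a) ^ q) = ((fun s : ℝ => 1 + β * s + a) ^ q)⁻¹ := by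
    funext x
    simp
  rw [e]
  refine h2.congr_deriv ?_
  rcases q with _ | q
  · simp
  · simp only [Pi.pow_apply, Nat.add_sub_cancel]
    have := h.ne'
    field_simp
    generalize 1 + β * s + a = x
    ring

lemma fmH_deriv (β a b : ℝ) (hβ : 0 < β) (ha : 0 ≤ a) (hab : a < b) (q : ℕ) (s : ℝ)
    (hs : 0 ≤ s) : HasDerivAt (fmH β a b q) (-(q * β) * fmH β a b (q + 1) s) s := by
  have hbs := mul_nonneg hβ.le hs
  have := (fm_aux β a q s (by linarith)).sub (fm_aux β b q s (by linarith))
  refine HasDerivAt.congr_deriv (f := fmH β a b q) this ?_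
  unfold fmH
  ring

lemma fmH_pos (β a b : ℝ) (hβ : 0 < β) (ha : 0 ≤ a) (hab : a < b) (q : ℕ) (hq : 1 ≤ q) (s : ℝ)
    (hs : 0 ≤ s) : 0 < fmH β a b q s := by
  have hbs := mul_nonneg hβ.le hs
  unfold fmH
  have h0 : 0 < 1 + β * s + a := by linarith
  exact sub_pos.2 (one_div_lt_one_div_of_lt (by positivity)
    (pow_lt_pow_left₀ (by linarith) h0.le (by omega)))

lemma fmH_cont (β a b : ℝ) (hβ : 0 < β) (ha : 0 ≤ a) (hab : a < b) (q : ℕ) :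
    ContinuousOn (fmH β a b q) (Set.Ici 0) := fun s hs =>
  (fmH_deriv β a b hβ ha hab q s hs).continuousAt.continuousWithinAt

lemma fmH_anti (β a b : ℝ) (hβ : 0 < β) (ha : 0 ≤ a) (hab : a < b) (q : ℕ) (hq : 1 ≤ q) :
    StrictAntiOn (fmH β a b q) (Set.Ici 0) := by
  refine strictAntiOn_of_deriv_neg (convex_Ici 0) (fmH_cont β a b hβ ha hab q) ?_
  intro s hs
  rw [interior_Ici] at hs
  have hs' : (0 : ℝ) ≤ s := le_of_lt hs
  rw [(fmH_deriv β a b hβ ha hab q s hs').deriv]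
  have := fmH_pos β a b hβ ha hab (q + 1) (by omega) s hs'
  have hq' : (0 : ℝ) < q := by exact_mod_cast hq
  have : 0 < q * β * fmH β a b (q + 1) s := by positivity
  linarith

lemma fmH_convex (β a b : ℝ) (hβ : 0 < β) (ha : 0 ≤ a) (hab : a < b) (q : ℕ) :
    ConvexOn ℝ (Set.Ici 0) (fmH β a b q) := by
  refine MonotoneOn.convexOn_of_deriv (convex_Ici 0) (fmH_cont β a b hβ ha hab q) ?_ ?_
  · intro s hs
    rw [interior_Ici] at hs
    exact (fmH_deriv β a b hβ ha hab q s
      (le_of_lt hs)).differentiableAt.differentiableWithinAt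
  · intro s hs t ht hst
    rw [interior_Ici] at hs ht
    have hs' : (0 : ℝ) ≤ s := le_of_lt hs
    have ht' : (0 : ℝ) ≤ t := le_of_lt ht
    rw [(fmH_deriv β a b hβ ha hab q s hs').deriv, (fmH_deriv β a b hβ ha hab q t ht').deriv]
    have h := (fmH_anti β a b hβ ha hab (q + 1) (by omega)).antitoneOn hs' ht' hst
    have hq : (0 : ℝ) ≤ q * β := by positivity
    nlinarith [mul_le_mul_of_nonneg_left h hq]

/-- FM-P3 (the frequency modulation principle) for the basic frequency modulating
function: for `p ≥ 1`, `τ ∈ (0,2]`, `α, β > 0` and `0 ≤ t₁ < t₂`, the function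
`h(s) = (1 + βs + α t₁^τ)^{−p} − (1 + βs + α t₂^τ)^{−p}` is positive, strictly
decreasing and convex on `[0,∞)`. -/
theorem basic_fm_principle (p : ℕ) (hp : 1 ≤ p)
    (τ : ℝ) (hτ : τ ∈ Set.Ioc (0 : ℝ) 2)
    (α β : ℝ) (hα : 0 < α) (hβ : 0 < β)
    (t₁ t₂ : ℝ) (ht₁ : 0 ≤ t₁) (ht : t₁ < t₂) :
    (∀ s ∈ Set.Ici (0 : ℝ),
        0 < 1 / (1 + β * s + α * t₁ ^ τ) ^ p - 1 / (1 + β * s + α * t₂ ^ τ) ^ p) ∧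
    StrictAntiOn
      (fun s : ℝ => 1 / (1 + β * s + α * t₁ ^ τ) ^ p - 1 / (1 + β * s + α * t₂ ^ τ) ^ p)
      (Set.Ici 0) ∧
    ConvexOn ℝ (Set.Ici 0)
      (fun s : ℝ => 1 / (1 + β * s + α * t₁ ^ τ) ^ p - 1 / (1 + β * s + α * t₂ ^ τ) ^ p) := by
  have ha : 0 ≤ α * t₁ ^ τ := mul_nonneg hα.le (Real.rpow_nonneg ht₁ τ)
  have hab : α * t₁ ^ τ < α * t₂ ^ τ :=
    mul_lt_mul_of_pos_left (Real.rpow_lt_rpow ht₁ ht hτ.1) hα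
  exact ⟨fun s hs => fmH_pos β _ _ hβ ha hab p hp s hs, fmH_anti β _ _ hβ ha hab p hp,
    fmH_convex β _ _ hβ ha hab p⟩
end

section
/- (Positive definiteness of the practical product FM kernel with f_Lap.) Let D ≥ 1 with positive scale parameters θ_1,…,θ_D, let P ≥ 1, and for each p ∈ {1,…,P} let n_p ≥ 1, let U^p be an n_p × n_p real orthogonal matrix, let λ^p_1,…,λ^p_{n_p} ≥ 0 be nonnegative reals, and let α_p ≥ 0, β_p ≥ 0. Then the function k on (ℝ^D × Π_{p=1}^P {1,…,n_p}) × (ℝ^D × Π_{p=1}^P {1,…,n_p}) defined by k((c, v), (c', v')) = Π_{p=1}^{P} Σ_{i=1}^{n_p} [U^p]_{v_p,i} · (1 + β_p λ^p_i + α_p ‖c − c'‖_θ²)^{−1} · [U^p]_{v'_p,i} is a positive definite kernel, where v = (v_1,…,v_P), v' = (v'_1,…,v'_P) and ‖c − c'‖_θ² = Σ_{d=1}^{D} (c_d − c'_d)² / θ_d². -/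
open scoped BigOperators Matrix

lemma fm_quad {m : ℕ} (f : Fin m → Fin m → ℝ) (a : Fin m → ℝ) :
    star a ⬝ᵥ (Matrix.of f *ᵥ a) = ∑ i, ∑ j, a i * a j * f i j := by
  simp only [dotProduct, Matrix.mulVec, Finset.mul_sum]
  refine Finset.sum_congr rfl fun i _ => Finset.sum_congr rfl fun j _ => ?_
  rw [Pi.star_apply, star_trivial, Matrix.of_apply]
  ring

lemma fm_psd_mk {m : ℕ} (f : Fin m → Fin m → ℝ) (hs : ∀ i j, f i j = f j i)
    (h : ∀ a : Fin m → ℝ, 0 ≤ ∑ i, ∑ j, a i * a j * f i j) :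
    (Matrix.of f).PosSemidef := by
  refine Matrix.PosSemidef.of_dotProduct_mulVec_nonneg ?_ ?_
  · ext i j; simp [hs i j]
  · intro a
    rw [fm_quad]
    exact h a

lemma fm_psd_nonneg {m : ℕ} {f : Fin m → Fin m → ℝ} (h : (Matrix.of f).PosSemidef)
    (a : Fin m → ℝ) : 0 ≤ ∑ i, ∑ j, a i * a j * f i j := by
  have := h.dotProduct_mulVec_nonneg a
  rwa [fm_quad] at this

lemma fm_psd_symm {m : ℕ} {f : Fin m → Fin m → ℝ} (h : (Matrix.of f).PosSemidef)
    (i j : Fin m) : f i j = f j i := by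
  simpa using h.1.apply j i

lemma fm_psd_rank {m : ℕ} (u : Fin m → ℝ) :
    (Matrix.of fun i j => u i * u j).PosSemidef := by
  refine fm_psd_mk _ (fun i j => mul_comm _ _) fun a => ?_
  have : ∑ i, ∑ j, a i * a j * (u i * u j) = (∑ i, a i * u i) ^ 2 := by
    rw [sq, Finset.sum_mul_sum]
    refine Finset.sum_congr rfl fun i _ => Finset.sum_congr rfl fun j _ => ?_
    ring
  rw [this]; positivity

lemma fm_psd_mul {m : ℕ} {f g : Fin m → Fin m → ℝ} (hf : (Matrix.of f).PosSemidef)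
    (hg : (Matrix.of g).PosSemidef) : (Matrix.of fun i j => f i j * g i j).PosSemidef :=
  hf.hadamard hg

lemma fm_psd_sum {m : ℕ} {ι : Type*} (s : Finset ι) {f : ι → Fin m → Fin m → ℝ}
    (hf : ∀ k, (Matrix.of (f k)).PosSemidef) :
    (Matrix.of fun i j => ∑ k ∈ s, f k i j).PosSemidef := by
  refine fm_psd_mk _ (fun i j => Finset.sum_congr rfl fun k _ => fm_psd_symm (hf k) i j)
    fun a => ?_
  have : ∑ i, ∑ j, a i * a j * ∑ k ∈ s, f k i j
      = ∑ k ∈ s, ∑ i, ∑ j, a i * a j * f k i j := by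
    simp only [Finset.mul_sum]
    symm
    rw [Finset.sum_comm]
    refine Finset.sum_congr rfl fun i _ => ?_
    rw [Finset.sum_comm]
  rw [this]
  exact Finset.sum_nonneg fun k _ => fm_psd_nonneg (hf k) a

lemma fm_psd_prod {m : ℕ} {ι : Type*} (s : Finset ι) {f : ι → Fin m → Fin m → ℝ}
    (hf : ∀ k, (Matrix.of (f k)).PosSemidef) :
    (Matrix.of fun i j => ∏ k ∈ s, f k i j).PosSemidef := by
  classical
  induction s using Finset.induction_on with
  | empty => simpa using fm_psd_rank (m := m) (fun _ => 1)
  | insert k s hk ih =>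
    simp only [Finset.prod_insert hk]
    exact fm_psd_mul (hf k) ih

lemma fm_psd_abs_lt {m : ℕ} {f : Fin m → Fin m → ℝ} (hf : (Matrix.of f).PosSemidef)
    (hd : ∀ i, f i i < 1) (i j : Fin m) : |f i j| < 1 := by
  have key : ∀ t : ℝ, 0 ≤ f i i + t * f i j + t * f j i + t * t * f j j := by
    intro t
    have := fm_psd_nonneg hf (fun k => (if k = i then 1 else 0) + (if k = j then t else 0))
    simp [add_mul, mul_add, Finset.sum_add_distrib] at this
    linarith
  have h1 := key 1
  have h2 := key (-1)
  have hs := fm_psd_symm hf i j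
  have := hd i
  have := hd j
  rw [abs_lt]; constructor <;> linarith

lemma fm_psd_geom {m : ℕ} {f : Fin m → Fin m → ℝ} (hf : (Matrix.of f).PosSemidef)
    (hd : ∀ i, f i i < 1) : (Matrix.of fun i j => (1 - f i j)⁻¹).PosSemidef := by
  refine fm_psd_mk _ (fun i j => by rw [fm_psd_symm hf i j]) fun a => ?_
  have hs : HasSum (fun k : ℕ => ∑ i, ∑ j, a i * a j * f i j ^ k)
      (∑ i, ∑ j, a i * a j * (1 - f i j)⁻¹) := by
    refine hasSum_sum fun i _ => hasSum_sum fun j _ => ?_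
    exact (hasSum_geometric_of_abs_lt_one (fm_psd_abs_lt hf hd i j)).mul_left _
  refine hs.nonneg fun k => ?_
  have := fm_psd_prod (Finset.range k) (f := fun _ => f) (fun _ => hf)
  simpa using fm_psd_nonneg this a

lemma fm_psd_inv {m D : ℕ} (c : Fin m → Fin D → ℝ) (θ : Fin D → ℝ)
    (A α : ℝ) (hA : 0 < A) (hα : 0 ≤ α) :
    (Matrix.of fun i j => (A + α * ∑ d, (c i d - c j d) ^ 2 / θ d ^ 2)⁻¹).PosSemidef := by
  set s : Fin m → ℝ := fun i => A / 2 + α * ∑ d, (c i d) ^ 2 / θ d ^ 2 with hs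
  have hs0 : ∀ i, 0 < 1 + s i := fun i => by
    have : 0 ≤ α * ∑ d, (c i d) ^ 2 / θ d ^ 2 :=
      mul_nonneg hα (Finset.sum_nonneg fun d _ => by positivity)
    simp only [hs]; linarith
  set u : Option (Fin D) → Fin m → ℝ := fun o i =>
    o.elim ((1 - s i) / (1 + s i)) (fun d => 2 * √α * (c i d / θ d) / (1 + s i)) with hu
  have hG := fm_psd_sum Finset.univ (fun o => fm_psd_rank (u o))
  have key : ∀ i j, 1 - ∑ o, u o i * u o j =
      2 / ((1 + s i) * (1 + s j)) * (A + α * ∑ d, (c i d - c j d) ^ 2 / θ d ^ 2) := by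
    intro i j
    have hi := (hs0 i).ne'
    have hj := (hs0 j).ne'
    have e1 : ∑ d, u (some d) i * u (some d) j =
        4 * α / ((1 + s i) * (1 + s j)) * ∑ d, c i d * c j d / θ d ^ 2 := by
      rw [Finset.mul_sum]
      refine Finset.sum_congr rfl fun d _ => ?_
      simp only [hu, Option.elim]
      have h := Real.mul_self_sqrt hα
      calc _ = 4 * (√α * √α) / ((1 + s i) * (1 + s j)) * (c i d * c j d / θ d ^ 2) := by
            simp only [div_eq_mul_inv, mul_inv]
            ring
        _ = _ := by rw [h]
    have e2 : ∑ d, (c i d - c j d) ^ 2 / θ d ^ 2 = ∑ d, (c i d) ^ 2 / θ d ^ 2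
        + ∑ d, (c j d) ^ 2 / θ d ^ 2 - 2 * ∑ d, c i d * c j d / θ d ^ 2 := by
      rw [Finset.mul_sum, ← Finset.sum_add_distrib, ← Finset.sum_sub_distrib]
      refine Finset.sum_congr rfl fun d _ => ?_
      ring
    have e3 : A + α * ∑ d, (c i d - c j d) ^ 2 / θ d ^ 2 =
        s i + s j - 2 * α * ∑ d, c i d * c j d / θ d ^ 2 := by
      rw [e2]; simp only [hs]; ring
    rw [Fintype.sum_option, e1, e3]
    simp only [hu, Option.elim]
    clear_value s
    field_simp
    ring
  have hd : ∀ i, ∑ o, u o i * u o i < 1 := by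
    intro i
    have h := key i i
    have := hs0 i
    have h2 : 0 < 2 / ((1 + s i) * (1 + s i)) * (A + α * ∑ d, (c i d - c i d) ^ 2 / θ d ^ 2) := by
      simp only [sub_self]
      simp
      positivity
    linarith
  have h := fm_psd_mul (fm_psd_rank fun i => √2 / (1 + s i)) (fm_psd_geom hG hd)
  convert h using 4 with i j
  rw [key]
  have hi := (hs0 i).ne'
  have hj := (hs0 j).ne'
  have h2 : √2 / (1 + s i) * (√2 / (1 + s j)) = 2 / ((1 + s i) * (1 + s j)) := by
    rw [div_mul_div_comm, Real.mul_self_sqrt (by norm_num)]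
  rw [h2, mul_inv, ← mul_assoc, mul_inv_cancel₀ (by positivity), one_mul]

/-- Positive definiteness of the practical product FM kernel with `f_Lap`:
`k((c,v),(c',v')) = ∏_p ∑_i [Uᵖ]_{v_p,i} (1 + β_p λᵖ_i + α_p‖c−c'‖_θ²)⁻¹ [Uᵖ]_{v'_p,i}`
is a positive definite kernel on `ℝ^D × (V_1 × ⋯ × V_P)`, where each `Uᵖ` is orthogonal
and the eigenvalues `λᵖ_i` are nonnegative; the shared distance
`‖c − c'‖_θ² = ∑ d, (c_d − c'_d)²/θ_d²` couples the `P` factors. -/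
theorem product_fm_kernel_pd {D : ℕ} (hD : 1 ≤ D)
    (θ : Fin D → ℝ) (hθ : ∀ d, 0 < θ d)
    {P : ℕ} (hP : 1 ≤ P)
    (n : Fin P → ℕ) (hn : ∀ p, 1 ≤ n p)
    (U : ∀ p : Fin P, Matrix (Fin (n p)) (Fin (n p)) ℝ)
    (hU : ∀ p, U p * (U p)ᵀ = 1)
    (lam : ∀ p : Fin P, Fin (n p) → ℝ) (hlam : ∀ p i, 0 ≤ lam p i)
    (α β : Fin P → ℝ) (hα : ∀ p, 0 ≤ α p) (hβ : ∀ p, 0 ≤ β p) :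
    IsPDKernel (fun x y : (Fin D → ℝ) × (∀ p : Fin P, Fin (n p)) =>
      ∏ p, ∑ i, U p (x.2 p) i *
        (1 + β p * lam p i + α p * ∑ d, (x.1 d - y.1 d) ^ 2 / θ d ^ 2)⁻¹ *
        U p (y.2 p) i) := by
  intro m x a
  have h := fm_psd_prod (m := m) Finset.univ
    (f := fun p i j => ∑ l, U p ((x i).2 p) l * U p ((x j).2 p) l *
        (1 + β p * lam p l + α p * ∑ d, ((x i).1 d - (x j).1 d) ^ 2 / θ d ^ 2)⁻¹)
    (fun p => fm_psd_sum Finset.univ fun l =>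
      fm_psd_mul (fm_psd_rank fun i => U p ((x i).2 p) l)
        (fm_psd_inv (fun i => (x i).1) θ _ _
          (by have := mul_nonneg (hβ p) (hlam p l); linarith) (hα p)))
  have h2 := fm_psd_nonneg h a
  simpa only [mul_right_comm] using h2
end
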